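/- Let n ≥ 1, 0 < α < n, 1 < p₁, p₂ < ∞. There is a constant c > 0 depending only on n, α, p₁, p₂ such that: whenever b ∈ BMO(ℝⁿ) with ‖b‖_* = 1, 0 < ε < 1, Q is a cube with center x_Q satisfying |Q|⁻¹ ∫_Q |b(y) − b_Q| dy > ε, f(y) = |Q|^{−1/p₁} sgn(b(y) − b_Q) χ_Q(y), g(y) = |Q| χ_{(2Q)^c}(y) |y − x_Q|^{−(n/p₂+n)}, and x ∈ (2nQ)^c, then |B_α((b − b_Q) f, g)(x)| ≥ c ε |Q|^{1/p₁' + 1} |x − x_Q|^{−2n − n/p₂ + α}, where 1/p₁' = 1 − 1/p₁. -/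

import Mathlib

open MeasureTheory Filter
open scoped ENNReal Topology

noncomputable section

/-- Euclidean space `ℝⁿ`. -/
abbrev Rn (n : ℕ) := EuclideanSpace ℝ (Fin n)

/-- Axis-parallel closed cube with center `c` and side length `r`. -/
def cube (n : ℕ) (c : Rn n) (r : ℝ) : Set (Rn n) := {y | ∀ i, |y i - c i| ≤ r / 2}

/-- Average of `b` over a set `Q`. -/
def avg (n : ℕ) (b : Rn n → ℝ) (Q : Set (Rn n)) : ℝ :=
  (volume Q).toReal⁻¹ * ∫ x in Q, b x

/-- Mean oscillation of `b` over a set `Q`. -/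
def osc (n : ℕ) (b : Rn n → ℝ) (Q : Set (Rn n)) : ℝ :=
  (volume Q).toReal⁻¹ * ∫ x in Q, |b x - avg n b Q|

/-- The BMO seminorm `‖b‖_*`, as an extended real number (supremum of the mean
oscillations over all cubes). -/
def bmoNorm (n : ℕ) (b : Rn n → ℝ) : ℝ≥0∞ :=
  ⨆ (c : Rn n) (r : {r : ℝ // 0 < r}), ENNReal.ofReal (osc n b (cube n c r.1))

/-- `b ∈ BMO(ℝⁿ)`. -/
def MemBMO (n : ℕ) (b : Rn n → ℝ) : Prop :=
  LocallyIntegrable b volume ∧ bmoNorm n b < ⊤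

/-- `b ∈ CMO(ℝⁿ)`: `b` lies in the closure of `C_c^∞(ℝⁿ)` in the BMO seminorm. -/
def MemCMO (n : ℕ) (b : Rn n → ℝ) : Prop :=
  LocallyIntegrable b volume ∧
  ∀ ε : ℝ, 0 < ε → ∃ g : Rn n → ℝ, ContDiff ℝ (⊤ : ℕ∞) g ∧ HasCompactSupport g ∧
    bmoNorm n (fun x => b x - g x) ≤ ENNReal.ofReal ε

/-- The bilinear fractional integral operator `B_α`. -/
def Bop (n : ℕ) (α : ℝ) (f g : Rn n → ℝ) (x : Rn n) : ℝ :=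
  ∫ y, f (x - y) * g (x + y) * ‖y‖ ^ (α - n)

/-- The first commutator `[b, B_α]₁`. -/
def commB (n : ℕ) (α : ℝ) (b f g : Rn n → ℝ) (x : Rn n) : ℝ :=
  ∫ y, (b x - b y) * f y * g ((2 : ℝ) • x - y) * ‖x - y‖ ^ (α - n)

/-- The bilinear fractional integral operator `I_α`. -/
def Iop (n : ℕ) (α : ℝ) (f₁ f₂ : Rn n → ℝ) (x : Rn n) : ℝ :=
  ∫ y₁, ∫ y₂, f₁ y₁ * f₂ y₂ * (‖x - y₁‖ ^ 2 + ‖x - y₂‖ ^ 2) ^ (α / 2 - n)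

/-- The iterated commutator `[Πb⃗, I_α]` with `b⃗ = (b, b)`. -/
def commI (n : ℕ) (α : ℝ) (b f₁ f₂ : Rn n → ℝ) (x : Rn n) : ℝ :=
  ∫ y₁, ∫ y₂, (b x - b y₁) * (b x - b y₂) * f₁ y₁ * f₂ y₂ *
    (‖x - y₁‖ ^ 2 + ‖x - y₂‖ ^ 2) ^ (α / 2 - n)

/-- The Muckenhoupt class `A_p`. -/
def MemAp (n : ℕ) (p : ℝ) (w : Rn n → ℝ) : Prop :=
  ∃ C : ℝ, ∀ (c : Rn n) (r : ℝ), 0 < r →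
    ((volume (cube n c r)).toReal⁻¹ * ∫ x in cube n c r, w x) *
      ((volume (cube n c r)).toReal⁻¹ * ∫ x in cube n c r, w x ^ (-(1 / (p - 1)))) ^ (p - 1) ≤ C

/-- The bilinear weight class `A_{P,q}` with `P = (p₁, p₂)`. -/
def MemAPq (n : ℕ) (p₁ p₂ q : ℝ) (w₁ w₂ : Rn n → ℝ) : Prop :=
  ∃ C : ℝ, ∀ (c : Rn n) (r : ℝ), 0 < r →
    ((volume (cube n c r)).toReal⁻¹ * ∫ x in cube n c r, w₁ x ^ q * w₂ x ^ q) *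
      ((volume (cube n c r)).toReal⁻¹ *
          ∫ x in cube n c r, w₁ x ^ (-(1 - 1 / p₁)⁻¹)) ^ (q * (1 - 1 / p₁)) *
      ((volume (cube n c r)).toReal⁻¹ *
          ∫ x in cube n c r, w₂ x ^ (-(1 - 1 / p₂)⁻¹)) ^ (q * (1 - 1 / p₂)) ≤ C

theorem isCompact_cube (n : ℕ) (c : Rn n) (r : ℝ) : IsCompact (cube n c r) := by
  have h : cube n c r = (EuclideanSpace.equiv (Fin n) ℝ).toHomeomorph ⁻¹'
      (Set.univ.pi fun i => Set.Icc (c i - r / 2) (c i + r / 2)) := by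
    ext y
    simp only [cube, Set.mem_ofPred_eq, Set.mem_preimage, Set.mem_univ_pi, Set.mem_Icc, abs_le]
    refine forall_congr' fun i => ?_
    change _ ↔ c i - r / 2 ≤ y i ∧ y i ≤ c i + r / 2
    constructor <;> rintro ⟨h₁, h₂⟩ <;> constructor <;> linarith
  rw [h, Homeomorph.isCompact_preimage]
  exact isCompact_univ_pi fun i => isCompact_Icc

theorem norm_sub_center_le_of_mem_cube {n : ℕ} {c u : Rn n} {r : ℝ} (hr : 0 < r)
    (hu : u ∈ cube n c r) : ‖u - c‖ ≤ n * r / 2 := by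
  rw [EuclideanSpace.norm_eq]
  refine Real.sqrt_le_iff.2 ⟨by positivity, ?_⟩
  have h : ∀ i ∈ Finset.univ, ‖(u - c) i‖ ^ 2 ≤ (r / 2) ^ 2 := fun i _ =>
    pow_le_pow_left₀ (norm_nonneg _) (hu i) 2
  refine (Finset.sum_le_card_nsmul _ _ _ h).trans ?_
  have hn : (n : ℝ) ≤ (n : ℝ) ^ 2 := by exact_mod_cast Nat.le_self_pow two_ne_zero n
  simp only [Finset.card_univ, Fintype.card_fin, nsmul_eq_mul]
  nlinarith [sq_nonneg (r / 2)]

theorem lt_norm_sub_center_of_notMem_cube {n : ℕ} {c x : Rn n} {r : ℝ}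
    (hx : x ∉ cube n c r) : r / 2 < ‖x - c‖ := by
  simp only [cube, Set.mem_ofPred_eq, not_forall, not_le] at hx
  obtain ⟨i, hi⟩ := hx
  exact hi.trans_le (PiLp.norm_apply_le (x - c) i)

theorem reflection_notMem_cube {n : ℕ} (hn : 1 ≤ n) {c x u : Rn n} {r : ℝ} (hr : 0 < r)
    (hx : x ∉ cube n c (2 * n * r)) (hu : u ∈ cube n c r) :
    x + (x - u) ∉ cube n c (2 * r) := by
  simp only [cube, Set.mem_ofPred_eq, not_forall, not_le] at hx ⊢
  obtain ⟨i, hi⟩ := hx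
  refine ⟨i, ?_⟩
  have hn' : (1 : ℝ) ≤ n := by exact_mod_cast hn
  have hu' := hu i
  have hsum : 2 * |x i - c i| ≤ |(x + (x - u)) i - c i| + |u i - c i| := by
    rw [show 2 * |x i - c i| = |2 * (x i - c i)| by rw [abs_mul, abs_two]]
    refine le_trans (le_of_eq ?_) (abs_add_le _ _)
    simp only [PiLp.add_apply, PiLp.sub_apply]
    congr 1
    ring
  nlinarith

theorem Bop_eq_integral_sub (n : ℕ) (α : ℝ) (f g : Rn n → ℝ) (x : Rn n) :
    Bop n α f g x = ∫ u, f u * g (x + (x - u)) * ‖x - u‖ ^ (α - n) := by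
  rw [← integral_sub_left_eq_self
    (fun u => f u * g (x + (x - u)) * ‖x - u‖ ^ (α - n)) volume x]
  simp only [sub_sub_cancel, Bop]

theorem mul_sign_eq_abs (t : ℝ) : t * Real.sign t = |t| := by
  rcases lt_trichotomy t 0 with h | h | h
  · rw [Real.sign_of_neg h, abs_of_neg h, mul_neg_one]
  · simp [h]
  · rw [Real.sign_of_pos h, abs_of_pos h, mul_one]

theorem Bop_cube_eq_setIntegral {n : ℕ} (hn : 1 ≤ n) (α p₁ β : ℝ) (b : Rn n → ℝ)
    {c x : Rn n} {r : ℝ} (hr : 0 < r) (a V : ℝ) (hx : x ∉ cube n c (2 * n * r)) :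
    Bop n α ((cube n c r).indicator fun y => (b y - a) * (V ^ (-(1 / p₁)) * Real.sign (b y - a)))
        ((cube n c (2 * r))ᶜ.indicator fun y => V * ‖y - c‖ ^ β) x =
      ∫ u in cube n c r, |b u - a| *
        (V ^ (-(1 / p₁)) * V * (‖x + (x - u) - c‖ ^ β * ‖x - u‖ ^ (α - n))) := by
  rw [Bop_eq_integral_sub, ← integral_indicator (isCompact_cube n c r).measurableSet]
  refine integral_congr_ae (Eventually.of_forall fun u => ?_)
  by_cases hu : u ∈ cube n c r
  · have h := reflection_notMem_cube hn hr hx hu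
    simp only [Set.indicator_of_mem hu, Set.indicator_of_mem (Set.mem_compl h),
      ← mul_sign_eq_abs]
    ring
  · simp only [Set.indicator_of_notMem hu, zero_mul]

theorem kernel_lower_bound {n : ℕ} {α β : ℝ} (hαn : α < n) (hβ : β ≤ 0) {c x u : Rn n}
    {r : ℝ} (hr : 0 < r) (hx : x ∉ cube n c (2 * n * r)) (hu : u ∈ cube n c r)
    (h₁ : 0 < ‖x + (x - u) - c‖) (h₂ : 0 < ‖x - u‖) :
    (3 : ℝ) ^ β * 2 ^ (α - n) * ‖x - c‖ ^ (β + (α - n)) ≤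
      ‖x + (x - u) - c‖ ^ β * ‖x - u‖ ^ (α - n) := by
  have hx' := lt_norm_sub_center_of_notMem_cube hx
  have hu' := norm_sub_center_le_of_mem_cube hr hu
  have hpos : 0 < ‖x - c‖ := lt_of_le_of_lt (by positivity) hx'
  have hle : ‖u - c‖ ≤ ‖x - c‖ := by
    have : (0 : ℝ) ≤ n * r := by positivity
    linarith
  have e₁ : ‖x + (x - u) - c‖ ≤ 3 * ‖x - c‖ := by
    rw [show x + (x - u) - c = (x - c) + (x - c) - (u - c) by abel]
    linarith [norm_sub_le ((x - c) + (x - c)) (u - c), norm_add_le (x - c) (x - c)]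
  have e₂ : ‖x - u‖ ≤ 2 * ‖x - c‖ := by
    rw [show x - u = (x - c) - (u - c) by abel]
    linarith [norm_sub_le (x - c) (u - c)]
  calc (3 : ℝ) ^ β * 2 ^ (α - n) * ‖x - c‖ ^ (β + (α - n))
      = (3 * ‖x - c‖) ^ β * (2 * ‖x - c‖) ^ (α - n) := by
        rw [Real.rpow_add hpos, Real.mul_rpow (by norm_num) hpos.le,
          Real.mul_rpow (by norm_num) hpos.le]
        ring
    _ ≤ _ := mul_le_mul (Real.rpow_le_rpow_of_nonpos h₁ e₁ hβ)
        (Real.rpow_le_rpow_of_nonpos h₂ e₂ (by linarith)) (by positivity) (by positivity)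

/-- pointwise lower bound `|B_α((b - b_Q)f, g)(x)| ≳ ε |Q|^{1/p₁'+1}
|x - x_Q|^{-2n - n/p₂ + α}` for `x ∈ (2nQ)^c`, when the mean oscillation of `b` on `Q`
exceeds `ε`. -/
theorem statement7 (n : ℕ) (hn : 1 ≤ n) (α p₁ p₂ : ℝ)
    (hα : 0 < α) (hαn : α < n) (hp₁ : 1 < p₁) (hp₂ : 1 < p₂) :
    ∃ C : ℝ, 0 < C ∧ ∀ (b : Rn n → ℝ) (ε : ℝ) (c : Rn n) (r : ℝ), 0 < r →
      LocallyIntegrable b volume → bmoNorm n b = 1 →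
      0 < ε → ε < 1 → ε < osc n b (cube n c r) →
      ∀ x : Rn n, x ∉ cube n c (2 * n * r) →
        C * ε * (volume (cube n c r)).toReal ^ (1 - 1 / p₁ + 1) *
            ‖x - c‖ ^ (-(2 * n) - n / p₂ + α) ≤
          |Bop n α
              ((cube n c r).indicator fun y =>
                (b y - avg n b (cube n c r)) *
                  ((volume (cube n c r)).toReal ^ (-(1 / p₁)) *
                    Real.sign (b y - avg n b (cube n c r))))
              ((cube n c (2 * r))ᶜ.indicator fun y =>
                (volume (cube n c r)).toReal * ‖y - c‖ ^ (-(↑n / p₂ + ↑n)))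
              x| := by
  refine ⟨(3 : ℝ) ^ (-((n : ℝ) / p₂ + n)) * 2 ^ (α - n), by positivity, ?_⟩
  intro b ε c r hr hb _ hε _ hosc x hx
  rw [Bop_cube_eq_setIntegral hn α p₁ _ b hr _ _ hx]
  have hQ := isCompact_cube n c r
  set β : ℝ := -((n : ℝ) / p₂ + n) with hβ_def
  set a := avg n b (cube n c r) with ha
  set V := (volume (cube n c r)).toReal with hV_def
  have hn' : (1 : ℝ) ≤ n := by exact_mod_cast hn
  have hβ : β ≤ 0 := by
    have : 0 ≤ (n : ℝ) / p₂ := by positivity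
    linarith
  have hosc' : ε < V⁻¹ * ∫ u in cube n c r, |b u - a| := hosc
  have hV : 0 < V := by
    refine lt_of_le_of_ne ENNReal.toReal_nonneg fun h => ?_
    rw [← h, inv_zero, zero_mul] at hosc'
    exact hε.not_gt hosc'
  have hint : ε * V ≤ ∫ u in cube n c r, |b u - a| := by
    rw [inv_mul_eq_div, lt_div_iff₀ hV] at hosc'
    exact hosc'.le
  have h₁ : ∀ u ∈ cube n c r, 0 < ‖x + (x - u) - c‖ := fun u hu =>
    lt_of_le_of_lt (by positivity)
      (lt_norm_sub_center_of_notMem_cube (reflection_notMem_cube hn hr hx hu))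
  have h₂ : ∀ u ∈ cube n c r, 0 < ‖x - u‖ := by
    intro u hu
    have hux := norm_sub_center_le_of_mem_cube hr hu
    have hxc := lt_norm_sub_center_of_notMem_cube hx
    have hnr : 0 < n * r := by positivity
    refine norm_pos_iff.2 (sub_ne_zero.2 fun h => ?_)
    rw [h] at hxc
    linarith
  have hbint : IntegrableOn (fun u => |b u - a|) (cube n c r) :=
    ((hb.integrableOn_isCompact hQ).sub
      (integrableOn_const hQ.measure_lt_top.ne)).abs
  have hcont : ContinuousOn (fun u => V ^ (-(1 / p₁)) * V *
      (‖x + (x - u) - c‖ ^ β * ‖x - u‖ ^ (α - n))) (cube n c r) := by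
    refine continuousOn_const.mul (ContinuousOn.mul ?_ ?_)
    · exact ContinuousOn.rpow_const (by fun_prop) fun u hu => Or.inl (h₁ u hu).ne'
    · exact ContinuousOn.rpow_const (by fun_prop) fun u hu => Or.inl (h₂ u hu).ne'
  set K := (3 : ℝ) ^ β * 2 ^ (α - n) * ‖x - c‖ ^ (β + (α - n)) with hK
  have hK0 : 0 ≤ K := by positivity
  have hexp : -(2 * (n : ℝ)) - n / p₂ + α = β + (α - n) := by
    rw [hβ_def]
    ring
  have hVpow : V ^ (1 - 1 / p₁ + 1) = V ^ (-(1 / p₁)) * V * V := by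
    rw [show 1 - 1 / p₁ + 1 = -(1 / p₁) + 1 + 1 by ring, Real.rpow_add_one hV.ne',
      Real.rpow_add_one hV.ne']
  refine le_trans ?_ (le_abs_self _)
  calc _ = ε * V * (V ^ (-(1 / p₁)) * V * K) := by
        rw [hVpow, hexp, hK]
        ring
    _ ≤ (∫ u in cube n c r, |b u - a|) * (V ^ (-(1 / p₁)) * V * K) :=
        mul_le_mul_of_nonneg_right hint (by positivity)
    _ = ∫ u in cube n c r, |b u - a| * (V ^ (-(1 / p₁)) * V * K) :=
        (integral_mul_const _ _).symm
    _ ≤ _ := by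
        refine setIntegral_mono_on (hbint.mul_const _)
          (hbint.mul_continuousOn hcont hQ) hQ.measurableSet fun u hu => ?_
        refine mul_le_mul_of_nonneg_left (mul_le_mul_of_nonneg_left ?_ (by positivity))
          (abs_nonneg _)
        exact kernel_lower_bound hαn hβ hr hx hu (h₁ u hu) (h₂ u hu)
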